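/- Let Ω ⊆ ℝⁿ be open and H : closure(Ω) × ℝⁿ → ℝ continuous. Let u be a continuous function on the closure of Ω that is a viscosity subsolution of u(x) + H(x, Du(x)) = 0 in Ω, and assume that v(x) ≤ u(x) for all x in the closure of Ω whenever v is a continuous viscosity subsolution of the same equation in Ω (i.e. u is the maximal continuous subsolution). Then u is a viscosity supersolution of u(x) + H(x, Du(x)) = 0 on the closure of Ω. -/

import Mathlib

open Metric Set MeasureTheory Filter
open scoped Topology NNReal RealInnerProductSpace

noncomputable section

abbrev Euc (n : ℕ) := EuclideanSpace ℝ (Fin n)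

/-- `v` is a viscosity subsolution of `v + H(x, Dv) = 0` in the open set `Ω`. -/
def IsViscositySubsolutionIn {n : ℕ} (Ω : Set (Euc n)) (H : Euc n → Euc n → ℝ)
    (v : Euc n → ℝ) : Prop :=
  ∀ x ∈ Ω, ∀ φ : Euc n → ℝ, ContDiff ℝ 1 φ →
    IsLocalMaxOn (fun y => v y - φ y) Ω x → v x + H x (gradient φ x) ≤ 0

/-- `v` is a viscosity supersolution of `v + H(x, Dv) = 0` on the closure of `Ω`. -/
def IsViscositySupersolutionOn {n : ℕ} (Ω : Set (Euc n)) (H : Euc n → Euc n → ℝ)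
    (v : Euc n → ℝ) : Prop :=
  ∀ x ∈ closure Ω, ∀ φ : Euc n → ℝ, ContDiff ℝ 1 φ →
    IsLocalMinOn (fun y => v y - φ y) (closure Ω) x → 0 ≤ v x + H x (gradient φ x)

/-- `v` is a state-constraint viscosity solution on `Ω`. -/
def IsStateConstraintSolution {n : ℕ} (Ω : Set (Euc n)) (H : Euc n → Euc n → ℝ)
    (v : Euc n → ℝ) : Prop :=
  ContinuousOn v (closure Ω) ∧ IsViscositySubsolutionIn Ω H v ∧
    IsViscositySupersolutionOn Ω H v

/-- Corollary 2.5: a maximal continuous viscosity subsolution is a viscosity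
supersolution on the closure. -/
theorem maximal_subsolution_is_supersolution {n : ℕ} (Ω : Set (Euc n)) (hΩ : IsOpen Ω)
    (H : Euc n → Euc n → ℝ)
    (hHcont : ContinuousOn (Function.uncurry H) (closure Ω ×ˢ (univ : Set (Euc n))))
    (u : Euc n → ℝ) (hucont : ContinuousOn u (closure Ω))
    (husub : IsViscositySubsolutionIn Ω H u)
    (hmax : ∀ v : Euc n → ℝ, ContinuousOn v (closure Ω) →
      IsViscositySubsolutionIn Ω H v → ∀ x ∈ closure Ω, v x ≤ u x) :
    IsViscositySupersolutionOn Ω H u := by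
  classical
  intro x₀ hx₀ φ hφ hmin
  by_contra hneg
  push Not at hneg
  obtain ⟨ψ, hψdef⟩ : ∃ ψ : Euc n → ℝ,
      ψ = fun y => φ y + (u x₀ - φ x₀) - ‖y - x₀‖ ^ 2 := ⟨_, rfl⟩
  have hq : ContDiff ℝ 1 (fun y : Euc n => ‖y - x₀‖ ^ 2) :=
    (contDiff_id.sub contDiff_const).norm_sq ℝ
  have hψ : ContDiff ℝ 1 ψ := by
    rw [hψdef]; exact (hφ.add contDiff_const).sub hq
  have hψ0 : ψ x₀ = u x₀ := by simp [hψdef]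
  have hgrad : gradient ψ x₀ = gradient φ x₀ := by
    have h0 : fderiv ℝ (fun y : Euc n => ‖y - x₀‖ ^ 2) x₀ = 0 := by
      apply IsLocalMin.fderiv_eq_zero
      refine Filter.Eventually.of_forall fun y => ?_
      simp
    have h1 : HasFDerivAt ψ (fderiv ℝ φ x₀ - 0) x₀ := by
      rw [hψdef, ← h0]
      exact (((hφ.differentiable one_ne_zero) x₀).hasFDerivAt.add_const _).sub
        ((hq.differentiable one_ne_zero) x₀).hasFDerivAt
    unfold gradient
    rw [h1.fderiv, sub_zero]
  have hgc : Continuous (gradient ψ) := by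
    unfold gradient
    exact (LinearIsometryEquiv.continuous _).comp (hψ.continuous_fderiv one_ne_zero)
  have hG : ContinuousOn (fun y => ψ y + H y (gradient ψ y)) (closure Ω) := by
    refine hψ.continuous.continuousOn.add ?_
    exact hHcont.comp (f := fun y => (y, gradient ψ y))
      (continuous_id.prodMk hgc).continuousOn (fun y hy => ⟨hy, mem_univ _⟩)
  obtain ⟨η, hη⟩ : ∃ η : ℝ, η = -(u x₀ + H x₀ (gradient φ x₀)) / 2 := ⟨_, rfl⟩
  have hηpos : 0 < η := by rw [hη]; linarith
  have hev1 : ∀ᶠ y in 𝓝[closure Ω] x₀, ψ y + H y (gradient ψ y) < -η := by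
    refine (hG x₀ hx₀).eventually_lt_const ?_
    simp only [hψ0, hgrad]
    rw [hη]; linarith
  have hev := hev1.and hmin
  rw [eventually_nhdsWithin_iff, Metric.eventually_nhds_iff] at hev
  obtain ⟨r, hr, hball⟩ := hev
  obtain ⟨δ, hδ⟩ : ∃ δ : ℝ, δ = min η (r ^ 2 / 8) := ⟨_, rfl⟩
  have hδpos : 0 < δ := by rw [hδ]; positivity
  have hδη : δ ≤ η := by rw [hδ]; exact min_le_left _ _
  have hδr : δ ≤ r ^ 2 / 8 := by rw [hδ]; exact min_le_right _ _
  have hlow : ∀ y ∈ closure Ω, dist y x₀ < r → r / 2 < dist y x₀ → ψ y + δ ≤ u y := by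
    intro y hy h1 h2
    have h3 := (hball h1 hy).2
    simp only at h3
    rw [dist_eq_norm] at h2
    have : r ^ 2 / 4 ≤ ‖y - x₀‖ ^ 2 := by nlinarith
    simp only [hψdef]
    nlinarith
  obtain ⟨v, hv⟩ : ∃ v : Euc n → ℝ,
      v = fun y => if dist y x₀ < r then max (u y) (ψ y + δ) else u y := ⟨_, rfl⟩
  have hvin : ∀ y, dist y x₀ < r → v y = max (u y) (ψ y + δ) := by
    intro y hy; simp [hv, hy]
  have hvout : ∀ y ∈ closure Ω, r / 2 < dist y x₀ → v y = u y := by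
    intro y hy h
    by_cases h1 : dist y x₀ < r
    · rw [hvin y h1]; exact max_eq_left (hlow y hy h1 h)
    · simp [hv, h1]
  have huv : ∀ y, u y ≤ v y := by
    intro y
    simp only [hv]
    split_ifs
    · exact le_max_left _ _
    · exact le_rfl
  have hvc : ContinuousOn v (closure Ω) := by
    intro y hy
    by_cases h1 : dist y x₀ < r
    · have hc : ContinuousWithinAt (fun y => max (u y) (ψ y + δ)) (closure Ω) y :=
        (hucont y hy).max ((hψ.continuous.add continuous_const).continuousWithinAt)
      refine hc.congr_of_eventuallyEq ?_ (hvin y h1)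
      have ho : {z : Euc n | dist z x₀ < r} ∈ 𝓝 y :=
        (isOpen_lt (by fun_prop) (by fun_prop)).mem_nhds h1
      filter_upwards [mem_nhdsWithin_of_mem_nhds ho] with z hz using hvin z hz
    · have h2 : r / 2 < dist y x₀ := by linarith
      refine (hucont y hy).congr_of_eventuallyEq ?_ (hvout y hy h2)
      have ho : {z : Euc n | r / 2 < dist z x₀} ∈ 𝓝 y :=
        (isOpen_lt (by fun_prop) (by fun_prop)).mem_nhds h2
      filter_upwards [mem_nhdsWithin_of_mem_nhds ho, self_mem_nhdsWithin] with z hz hz'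
        using hvout z hz' hz
  have hvsub : IsViscositySubsolutionIn Ω H v := by
    intro x hx χ hχ hloc
    by_cases hxe : v x = u x
    · rw [hxe]
      refine husub x hx χ hχ ?_
      filter_upwards [hloc] with y hy
      have := huv y
      simp only [hxe] at hy ⊢
      linarith
    · have h1 : dist x x₀ < r := by
        by_contra h
        exact hxe (by simp [hv, h])
      have hvx : v x = ψ x + δ := by
        have := hvin x h1
        rcases max_choice (u x) (ψ x + δ) with h | h
        · exact absurd (this.trans h) hxe
        · exact this.trans h
      have hloc' : IsLocalMax (fun y => ψ y - χ y) x := by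
        have hl : ∀ᶠ y in 𝓝 x, v y - χ y ≤ v x - χ x := by
          have := hloc
          unfold IsLocalMaxOn IsMaxFilter at this
          rwa [hΩ.nhdsWithin_eq hx] at this
        have ho : {z : Euc n | dist z x₀ < r} ∈ 𝓝 x :=
          (isOpen_lt (by fun_prop) (by fun_prop)).mem_nhds h1
        filter_upwards [hl, ho] with y hy hy'
        have h2 := hvin y hy'
        have h3 := le_max_right (u y) (ψ y + δ)
        linarith
      have hfd : gradient χ x = gradient ψ x := by
        have h0 := hloc'.fderiv_eq_zero
        have h4 := ((hψ.differentiable one_ne_zero x).hasFDerivAt.sub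
          (hχ.differentiable one_ne_zero x).hasFDerivAt).fderiv
        have h5 : fderiv ℝ ψ x - fderiv ℝ χ x = 0 := h4.symm.trans h0
        unfold gradient
        rw [sub_eq_zero.mp h5]
      have h6 := (hball h1 (subset_closure hx)).1
      rw [hfd, hvx]
      linarith
  have hfin := hmax v hvc hvsub x₀ hx₀
  have h7 := hvin x₀ (by simpa using hr)
  have h8 := le_max_right (u x₀) (ψ x₀ + δ)
  linarith
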